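/- Let D be uniformly distributed on the complex sphere {d ∈ ℂ^n : ‖d‖² = nρ} and W a standard complex circular Gaussian vector CN(0, I_n) independent of D. Then the density of Y = D + W at y ∈ ℂ^n (y ≠ 0), with respect to Lebesgue measure on ℂ^n ≅ ℝ^{2n}, is p_Y(y) = Γ(n) π^{−n} (nρ)^{(1−n)/2} ‖y‖^{1−n} exp(−(‖y‖² + nρ)) · I_{n−1}(2‖y‖√(nρ)). -/

import Mathlib

open MeasureTheory Real

/-- Modified Bessel function of the first kind `I_ν(x)`, via its power series. -/
noncomputable def besselI (ν x : ℝ) : ℝ :=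
  ∑' k : ℕ, (x / 2) ^ (2 * (k : ℝ) + ν) / ((Nat.factorial k : ℝ) * Real.Gamma (k + ν + 1))

/-- The circular complex Gaussian `CN(0, 2v)`: real and imaginary parts independent `N(0, v)`. -/
noncomputable def complexGaussian (v : NNReal) : Measure ℂ :=
  ((ProbabilityTheory.gaussianReal 0 v).prod (ProbabilityTheory.gaussianReal 0 v)).map
    (fun p => (p.1 : ℂ) + p.2 * Complex.I)

lemma complexGaussian_half : complexGaussian (1/2) =
    volume.withDensity (fun z : ℂ => ENNReal.ofReal (π⁻¹ * exp (-‖z‖^2))) := by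
  have h1 : ∀ x : ℝ, ProbabilityTheory.gaussianPDFReal 0 (1/2) x = (√π)⁻¹ * exp (-x^2) := by
    intro x
    simp [ProbabilityTheory.gaussianPDFReal]
    field_simp
  have hm := Complex.volume_preserving_equiv_real_prod.symm
  have hf : (fun p : ℝ × ℝ => (p.1 : ℂ) + p.2 * Complex.I) = Complex.measurableEquivRealProd.symm := by
    ext p
    simp [Complex.measurableEquivRealProd_symm_apply, Complex.mk_eq_add_mul_I]
  have hmeas : Measurable (fun z : ℂ => ENNReal.ofReal (π⁻¹ * exp (-‖z‖^2))) := by fun_prop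
  rw [complexGaussian, ProbabilityTheory.gaussianReal_of_var_ne_zero _ (by norm_num),
    prod_withDensity (by fun_prop) (by fun_prop), hf, ← hm.map_eq]
  ext s hs
  rw [withDensity_apply _ hs, setLIntegral_map hs hmeas hm.measurable,
    Measure.map_apply hm.measurable hs, withDensity_apply _ (hm.measurable hs)]
  refine lintegral_congr fun p => ?_
  simp only [ProbabilityTheory.gaussianPDF]
  rw [← ENNReal.ofReal_mul (ProbabilityTheory.gaussianPDFReal_nonneg _ _ _), h1, h1]
  congr 1
  rw [← Complex.normSq_eq_norm_sq, Complex.normSq_apply]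
  have e : (√π)⁻¹ * (√π)⁻¹ = π⁻¹ := by
    rw [← mul_inv, Real.mul_self_sqrt pi_pos.le]
  rw [← e]
  simp only [Complex.measurableEquivRealProd_symm_apply]
  rw [show -(p.1*p.1+p.2*p.2) = -p.1^2 + -p.2^2 by ring, Real.exp_add]
  ring

instance : IsProbabilityMeasure (complexGaussian (1/2)) := by
  unfold complexGaussian
  exact Measure.isProbabilityMeasure_map (by fun_prop)

lemma pi_complexGaussian (n : ℕ) :
    Measure.pi (fun _ : Fin n => complexGaussian (1 / 2)) =
    volume.withDensity (fun y : Fin n → ℂ =>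
      ENNReal.ofReal ((π⁻¹)^n * exp (-∑ i, ‖y i‖^2))) := by
  have hφm : Measurable (fun z : ℂ => π⁻¹ * exp (-‖z‖^2)) := by fun_prop
  have hφ0 : ∀ z : ℂ, 0 ≤ π⁻¹ * exp (-‖z‖^2) := fun z => by positivity
  have hφi : Integrable (fun z : ℂ => π⁻¹ * exp (-‖z‖^2)) := by
    refine ⟨hφm.aestronglyMeasurable, ?_⟩
    rw [hasFiniteIntegral_iff_ofReal (Filter.Eventually.of_forall hφ0)]
    have h := measure_univ (μ := complexGaussian (1/2))
    rw [complexGaussian_half, withDensity_apply _ MeasurableSet.univ, setLIntegral_univ] at h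
    rw [h]; simp
  refine Measure.pi_eq fun s hs => ?_
  have hnn : ∀ i (z : ℂ), 0 ≤ (s i).indicator (fun z : ℂ => π⁻¹ * exp (-‖z‖^2)) z :=
    fun i z => Set.indicator_nonneg (fun z _ => hφ0 z) z
  have hint : ∀ i, Integrable ((s i).indicator (fun z : ℂ => π⁻¹ * exp (-‖z‖^2))) :=
    fun i => hφi.indicator (hs i)
  rw [withDensity_apply _ (MeasurableSet.univ_pi hs), ← lintegral_indicator (MeasurableSet.univ_pi hs)]
  have e1 : ∀ i, complexGaussian (1/2) (s i) =
      ENNReal.ofReal (∫ z, (s i).indicator (fun z : ℂ => π⁻¹ * exp (-‖z‖^2)) z) := by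
    intro i
    rw [complexGaussian_half, withDensity_apply _ (hs i), integral_indicator (hs i),
      ofReal_integral_eq_lintegral_ofReal hφi.integrableOn (Filter.Eventually.of_forall hφ0)]
  simp_rw [e1]
  rw [← ENNReal.ofReal_prod_of_nonneg (fun i _ => integral_nonneg (hnn i)),
    ← integral_fintype_prod_volume_eq_prod, ofReal_integral_eq_lintegral_ofReal
      (μ := (volume : Measure (Fin n → ℂ))) (Integrable.fintype_prod hint)
      (Filter.Eventually.of_forall fun y => Finset.prod_nonneg fun i _ => hnn i _)]
  refine lintegral_congr fun y => ?_
  by_cases hy : y ∈ Set.univ.pi s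
  · rw [Set.indicator_of_mem hy]
    congr 1
    rw [Finset.prod_congr rfl (fun i _ => Set.indicator_of_mem (hy i (Set.mem_univ i)) _),
      Finset.prod_mul_distrib, ← Real.exp_sum]
    simp
  · rw [Set.indicator_of_notMem hy]
    simp only [Set.mem_pi, Set.mem_univ, true_implies, not_forall] at hy
    obtain ⟨i, hi⟩ := hy
    rw [Finset.prod_eq_zero (Finset.mem_univ i) (Set.indicator_of_notMem hi _)]
    simp

/-- action of a unitary on coordinates -/
noncomputable def actU {n : ℕ} (U : EuclideanSpace ℂ (Fin n) ≃ₗᵢ[ℂ] EuclideanSpace ℂ (Fin n))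
    (d : Fin n → ℂ) : Fin n → ℂ :=
  WithLp.equiv 2 (Fin n → ℂ) (U ((WithLp.equiv 2 (Fin n → ℂ)).symm d))

/-- real inner product -/
noncomputable def ipB {n : ℕ} (y d : Fin n → ℂ) : ℝ := ∑ i, (y i * (starRingEnd ℂ) (d i)).re

lemma ipB_eq {n : ℕ} (y d : Fin n → ℂ) :
    ipB y d = (inner ℂ (WithLp.toLp 2 d) (WithLp.toLp 2 y) : ℂ).re := by
  simp [ipB, PiLp.inner_apply]

lemma ipB_act {n : ℕ} (U : EuclideanSpace ℂ (Fin n) ≃ₗᵢ[ℂ] EuclideanSpace ℂ (Fin n))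
    (y d : Fin n → ℂ) : ipB (actU U y) (actU U d) = ipB y d := by
  rw [ipB_eq, ipB_eq]
  simp [actU]

lemma q_eq {n : ℕ} (y : Fin n → ℂ) : ∑ i, ‖y i‖^2 = ‖WithLp.toLp 2 y‖^2 := by
  rw [EuclideanSpace.norm_sq_eq]

lemma q_act {n : ℕ} (U : EuclideanSpace ℂ (Fin n) ≃ₗᵢ[ℂ] EuclideanSpace ℂ (Fin n))
    (y : Fin n → ℂ) : ∑ i, ‖actU U y i‖^2 = ∑ i, ‖y i‖^2 := by
  rw [q_eq, q_eq]
  simp [actU]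

lemma actU_continuous {n : ℕ} (U : EuclideanSpace ℂ (Fin n) ≃ₗᵢ[ℂ] EuclideanSpace ℂ (Fin n)) :
    Continuous (actU U) := by
  unfold actU
  exact (PiLp.continuous_ofLp 2 _).comp (U.continuous.comp (PiLp.continuous_toLp 2 _))

lemma exists_unitary {E : Type*} [NormedAddCommGroup E] [InnerProductSpace ℂ E]
    [FiniteDimensional ℂ E] (u v : E) (hu : ‖u‖ = 1) (hv : ‖v‖ = 1) : ∃ U : E ≃ₗᵢ[ℂ] E, U u = v := by
  let a := LinearIsometryEquiv.toSpanUnitSingleton (𝕜 := ℂ) u hu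
  let b := LinearIsometryEquiv.toSpanUnitSingleton (𝕜 := ℂ) v hv
  let L : (Submodule.span ℂ {u}) →ₗᵢ[ℂ] E :=
    (Submodule.span ℂ {v}).subtypeₗᵢ.comp (a.symm.trans b).toLinearIsometry
  refine ⟨L.extend.toLinearIsometryEquiv rfl, ?_⟩
  have h := LinearIsometry.extend_apply L (a 1)
  have ha : ((a 1 : Submodule.span ℂ {u}) : E) = u := by simp [a]
  rw [ha] at h
  have hL : L (a 1) = v := by simp [L, b]
  rw [hL] at h
  simpa using h

lemma exists_actU {n : ℕ} (y y' : Fin n → ℂ) 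
    (h : ∑ i, ‖y i‖^2 = ∑ i, ‖y' i‖^2) : ∃ U, actU U y = y' := by
  rw [q_eq, q_eq] at h
  have h' := (sq_eq_sq₀ (norm_nonneg _) (norm_nonneg _)).1 h
  by_cases h0 : WithLp.toLp 2 y = 0
  · rw [h0, norm_zero, eq_comm, norm_eq_zero] at h'
    refine ⟨LinearIsometryEquiv.refl ℂ _, ?_⟩
    simp at h0 h'
    simp [actU, h0, h']
  · set r := ‖WithLp.toLp 2 y‖ with hr
    have hr0 : r ≠ 0 := norm_ne_zero_iff.2 h0
    have hr0' : (r : ℂ) ≠ 0 := by exact_mod_cast hr0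
    obtain ⟨U, hU⟩ := exists_unitary ((r : ℂ)⁻¹ • WithLp.toLp 2 y) ((r : ℂ)⁻¹ • WithLp.toLp 2 y')
      (by rw [norm_smul, ← hr, norm_inv, Complex.norm_real, hr, norm_norm, ← hr]; field_simp)
      (by rw [norm_smul, ← h', norm_inv, Complex.norm_real, hr, norm_norm, ← hr]; field_simp)
    refine ⟨U, ?_⟩
    have : U (WithLp.toLp 2 y) = WithLp.toLp 2 y' := by
      rw [map_smul] at hU
      exact smul_right_injective _ (inv_ne_zero hr0') hU
    simp [actU, this]

lemma actU_mp {n : ℕ} (U : EuclideanSpace ℂ (Fin n) ≃ₗᵢ[ℂ] EuclideanSpace ℂ (Fin n)) :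
    MeasurePreserving (actU U) (volume : Measure (Fin n → ℂ)) volume := by
  let L : (Fin n → ℂ) ≃L[ℝ] (Fin n → ℂ) :=
    (((PiLp.continuousLinearEquiv 2 ℂ (fun _ : Fin n => ℂ)).symm.trans
      U.toContinuousLinearEquiv).trans
       (PiLp.continuousLinearEquiv 2 ℂ (fun _ : Fin n => ℂ))).restrictScalars ℝ
  have hL : (L : (Fin n → ℂ) → (Fin n → ℂ)) = actU U := rfl
  refine ⟨(actU_continuous U).measurable, ?_⟩
  rw [← hL]
  have : (Measure.map L (volume : Measure (Fin n → ℂ))).IsAddHaarMeasure :=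
    ContinuousLinearEquiv.isAddHaarMeasure_map L _
  have h := Measure.isAddLeftInvariant_eq_smul (Measure.map L (volume : Measure (Fin n → ℂ))) volume
  set c := Measure.addHaarScalarFactor (Measure.map L (volume : Measure (Fin n → ℂ))) volume
  let S : Set (Fin n → ℂ) := {y | ∑ i, ‖y i‖^2 < 1}
  have hSo : IsOpen S := isOpen_lt (by fun_prop) continuous_const
  have hS0 : volume S ≠ 0 := (hSo.measure_pos _ ⟨0, by simp [S]⟩).ne'
  have hSf : volume S ≠ ⊤ := by
    refine ((measure_mono (?_ : S ⊆ Metric.closedBall 0 1)).trans_lt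
      measure_closedBall_lt_top).ne
    intro y hy
    rw [mem_closedBall_zero_iff, pi_norm_le_iff_of_nonneg zero_le_one]
    intro i
    have : ‖y i‖^2 ≤ ∑ i, ‖y i‖^2 :=
      Finset.single_le_sum (f := fun i => ‖y i‖^2) (fun i _ => by positivity) (Finset.mem_univ i)
    have h2 : ∑ i, ‖y i‖^2 < 1 := hy
    nlinarith [norm_nonneg (y i)]
  have hS : Measure.map L (volume : Measure (Fin n → ℂ)) S = volume S := by
    rw [Measure.map_apply L.continuous.measurable hSo.measurableSet]
    congr 1
    ext y
    simp only [S, Set.mem_preimage, Set.mem_ofPred_eq, hL, q_act]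
  have h2 : (c : ENNReal) * volume S = 1 * volume S := by
    rw [one_mul]
    nth_rewrite 2 [← hS]
    rw [h]; rfl
  have hc : (c : ENNReal) = 1 := (ENNReal.mul_left_inj hS0 hSf).1 h2
  have hc' : c = 1 := by exact_mod_cast hc
  rw [h, hc', one_smul]

/-- the Gaussian law -/
noncomputable def gam (n : ℕ) : Measure (Fin n → ℂ) :=
  Measure.pi (fun _ : Fin n => complexGaussian (1 / 2))

instance (n : ℕ) : IsProbabilityMeasure (gam n) := by unfold gam; infer_instance

lemma gam_eq (n : ℕ) : gam n = volume.withDensity (fun y : Fin n → ℂ =>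
      ENNReal.ofReal ((π⁻¹)^n * exp (-∑ i, ‖y i‖^2))) := pi_complexGaussian n

lemma gam_mp {n : ℕ} (U : EuclideanSpace ℂ (Fin n) ≃ₗᵢ[ℂ] EuclideanSpace ℂ (Fin n)) :
    (gam n).map (actU U) = gam n := by
  have hm := actU_mp U
  rw [gam_eq]
  ext s hs
  have hmeas : Measurable (fun y : Fin n → ℂ =>
      ENNReal.ofReal ((π⁻¹)^n * exp (-∑ i, ‖y i‖^2))) := by fun_prop
  rw [Measure.map_apply hm.measurable hs, withDensity_apply _ (hm.measurable hs),
    withDensity_apply _ hs]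
  nth_rewrite 2 [← hm.map_eq]
  rw [setLIntegral_map hs hmeas hm.measurable]
  simp_rw [q_act]

lemma gam_radial (n : ℕ) (hn : 1 ≤ n) : ∃ A : ℝ, ∀ k : ℕ,
    ∫⁻ y, ENNReal.ofReal ((∑ i, ‖y i‖^2)^k) ∂(gam n) = ENNReal.ofReal (A * Gamma (n + k)) := by
  let E := EuclideanSpace ℂ (Fin n)
  let L : (Fin n → ℂ) ≃L[ℝ] E :=
    (PiLp.continuousLinearEquiv 2 ℝ (fun _ : Fin n => ℂ)).symm
  let ν : Measure E := Measure.map L volume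
  have hν : ν.IsAddHaarMeasure := ContinuousLinearEquiv.isAddHaarMeasure_map L _
  have hfr : Module.finrank ℝ E = 2 * n := by
    rw [← LinearEquiv.finrank_eq L.toLinearEquiv]
    simp [Module.finrank_pi_fintype, mul_comm]
  have : Nontrivial E := by
    apply Module.nontrivial_of_finrank_pos (R := ℝ)
    omega
  have hpow : ∀ k : ℕ, ∀ x ∈ Set.Ioi (0:ℝ), x ^ (2*n-1) • (x^(2*k) * exp (-x^2)) =
      x ^ (((2*n-1+2*k : ℕ)) : ℝ) * exp (-x^(2:ℝ)) := by
    intro k x hx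
    rw [rpow_natCast, smul_eq_mul, ← mul_assoc, ← pow_add]
    norm_cast
  have hI : ∀ k : ℕ, Integrable (fun x : E => ‖x‖^(2*k) * exp (-‖x‖^2)) ν := by
    intro k
    rw [integrable_fun_norm_addHaar ν (f := fun r : ℝ => r^(2*k) * exp (-r^2)), hfr]
    rw [integrableOn_congr_fun (hpow k) measurableSet_Ioi]
    exact integrableOn_rpow_mul_exp_neg_rpow
      (lt_of_lt_of_le (by norm_num) (Nat.cast_nonneg _)) (by norm_num)
  have hV : ∀ k : ℕ, ∫ x : E, ‖x‖^(2*k) * exp (-‖x‖^2) ∂ν =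
      (n * ν.real (Metric.ball 0 1)) * Gamma (n + k) := by
    intro k
    rw [integral_fun_norm_addHaar ν (fun r : ℝ => r^(2*k) * exp (-r^2)), hfr]
    rw [setIntegral_congr_fun measurableSet_Ioi (hpow k), integral_rpow_mul_exp_neg_rpow
      (by norm_num) (lt_of_lt_of_le (by norm_num) (Nat.cast_nonneg _))]
    have : (((2*n-1+2*k : ℕ) : ℝ) + 1) / 2 = n + k := by
      have : 2*n-1+2*k+1 = 2*n+2*k := by omega
      have h : ((2*n-1+2*k : ℕ) : ℝ) + 1 = 2 * n + 2 * k := by exact_mod_cast this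
      rw [h]; ring
    rw [this]
    simp only [nsmul_eq_mul, smul_eq_mul]
    push_cast
    ring
  refine ⟨(π⁻¹)^n * (n * ν.real (Metric.ball 0 1)), fun k => ?_⟩
  rw [mul_assoc, ← hV k, ← integral_const_mul, ofReal_integral_eq_lintegral_ofReal
    ((hI k).const_mul _) (Filter.Eventually.of_forall fun x => by positivity)]
  rw [lintegral_map (by fun_prop) L.continuous.measurable, gam_eq,
    lintegral_withDensity_eq_lintegral_mul _ (by fun_prop) (by fun_prop)]
  refine lintegral_congr fun y => ?_
  simp only [Pi.mul_apply]
  rw [← ENNReal.ofReal_mul (by positivity)]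
  congr 1
  have : ∑ i, ‖y i‖^2 = ‖L y‖^2 := q_eq y
  rw [this, pow_mul]
  ring

lemma gam_radial' (n : ℕ) (hn : 1 ≤ n) (k : ℕ) :
    ∫⁻ y, ENNReal.ofReal ((∑ i, ‖y i‖^2)^k) ∂(gam n) =
      ENNReal.ofReal (Gamma (n + k) / Gamma n) := by
  obtain ⟨A, hA⟩ := gam_radial n hn
  have hG : 0 < Gamma n := Gamma_pos_of_pos (by exact_mod_cast hn)
  have h0 := hA 0
  simp at h0
  rw [eq_comm, ENNReal.ofReal_eq_one] at h0
  rw [hA k]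
  congr 1
  field_simp
  linarith

lemma gauss_moment (k : ℕ) :
    ∫⁻ x, ENNReal.ofReal ((2*x)^(2*k)) ∂(ProbabilityTheory.gaussianReal 0 (1/2)) =
     ENNReal.ofReal ((2*k).factorial / k.factorial) := by
  have h1 : ∀ x : ℝ, ProbabilityTheory.gaussianPDFReal 0 (1/2) x = (√π)⁻¹ * exp (-x^2) := by
    intro x
    simp [ProbabilityTheory.gaussianPDFReal]
    field_simp
  have hi : Integrable (fun x : ℝ => x^(2*k) * exp (-x^2)) := by
    have := integrable_rpow_mul_exp_neg_mul_sq (b := 1) one_pos (s := ((2*k : ℕ) : ℝ))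
      (lt_of_lt_of_le (by norm_num) (Nat.cast_nonneg _))
    simpa only [rpow_natCast, neg_mul, one_mul] using this
  have hv : ∫ x : ℝ, x^(2*k) * exp (-x^2) = Gamma (k + 1/2) := by
    have e : ∀ x : ℝ, x^(2*k) * exp (-x^2) = |x|^(2*k) * exp (-|x|^2) := by
      intro x; rw [sq_abs, pow_mul, pow_mul, sq_abs]
    rw [integral_congr_ae (Filter.Eventually.of_forall e), integral_comp_abs (f := fun x : ℝ => x^(2*k) * exp (-x^2))]
    have hp : ∀ x ∈ Set.Ioi (0:ℝ), x^(2*k) * exp (-x^2) = x^((2*k:ℕ):ℝ) * exp (-x^(2:ℝ)) := by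
      intro x hx
      rw [rpow_natCast]; norm_cast
    rw [setIntegral_congr_fun measurableSet_Ioi hp, integral_rpow_mul_exp_neg_rpow
      (by norm_num) (lt_of_lt_of_le (by norm_num) (Nat.cast_nonneg _))]
    have : (((2*k : ℕ) : ℝ) + 1)/2 = k + 1/2 := by push_cast; ring
    rw [this]; ring
  rw [ProbabilityTheory.gaussianReal_of_var_ne_zero _ (by norm_num),
    lintegral_withDensity_eq_lintegral_mul _ (by fun_prop) (by fun_prop)]
  have e : ∀ x : ℝ, (ProbabilityTheory.gaussianPDF 0 (1/2) * 
      fun x => ENNReal.ofReal ((2*x)^(2*k))) x = 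
      ENNReal.ofReal (((√π)⁻¹ * 4^k) * (x^(2*k) * exp (-x^2))) := by
    intro x
    simp only [Pi.mul_apply, ProbabilityTheory.gaussianPDF]
    rw [← ENNReal.ofReal_mul (ProbabilityTheory.gaussianPDFReal_nonneg _ _ _), h1]
    congr 1
    rw [mul_pow, pow_mul 2]
    ring
  simp_rw [e]
  rw [← ofReal_integral_eq_lintegral_ofReal (hi.const_mul _)
    (Filter.Eventually.of_forall fun x => by
      have : 0 ≤ x^(2*k) := by rw [pow_mul]; positivity
      positivity), integral_const_mul, hv, Gamma_nat_add_half]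
  congr 1
  have hf : ((2*k).factorial : ℝ) = 2^k * k.factorial * ((2*k-1).doubleFactorial : ℕ) := by
    rcases k with _ | k
    · simp
    · have h := Nat.factorial_eq_mul_doubleFactorial (2*k+1)
      have h2 := Nat.doubleFactorial_two_mul (k+1)
      rw [show 2*(k+1) = 2*k+1+1 by ring] at h2 ⊢
      rw [h, h2]
      push_cast
      rfl
  rw [hf, show (4:ℝ) = 2 * 2 by norm_num, mul_pow]
  have := k.factorial_pos
  have hs : √π ≠ 0 := by positivity
  field_simp

lemma gam_moment (n : ℕ) (i : Fin n) (k : ℕ) :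
    ∫⁻ y, ENNReal.ofReal ((2 * (y i).re)^(2*k)) ∂(gam n) =
      ENNReal.ofReal ((2*k).factorial / k.factorial) := by
  have h := (measurePreserving_eval (fun _ : Fin n => complexGaussian (1 / 2)) i)
  have h2 := h.lintegral_comp (f := fun z : ℂ => ENNReal.ofReal ((2 * z.re)^(2*k)))
    (by fun_prop)
  unfold gam
  refine h2.trans ?_
  unfold complexGaussian
  rw [lintegral_map (by fun_prop) (by fun_prop), ← gauss_moment k]
  have h3 := (measurePreserving_fst (μ := ProbabilityTheory.gaussianReal 0 (1/2))
    (ν := ProbabilityTheory.gaussianReal 0 (1/2))).lintegral_comp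
    (f := fun x : ℝ => ENNReal.ofReal ((2 * x)^(2*k))) (by fun_prop)
  rw [← h3]
  simp

@[fun_prop]
lemma ipB_cont {n : ℕ} : Continuous (fun p : (Fin n → ℂ) × (Fin n → ℂ) => ipB p.1 p.2) := by
  unfold ipB
  fun_prop

lemma ipB_meas {n : ℕ} : Measurable (fun p : (Fin n → ℂ) × (Fin n → ℂ) => ipB p.1 p.2) :=
  ipB_cont.measurable

lemma ipB_meas_left {n : ℕ} (d : Fin n → ℂ) : Measurable (fun y : Fin n → ℂ => ipB y d) :=
  ipB_meas.comp (by fun_prop : Measurable fun y : Fin n → ℂ => (y, d))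

lemma ipB_comm {n : ℕ} (y d : Fin n → ℂ) : ipB y d = ipB d y := by
  unfold ipB
  refine Finset.sum_congr rfl fun i _ => ?_
  simp
  ring

lemma moment_inv {n : ℕ} (i₀ : Fin n) (m : Measure (Fin n → ℂ))
    (hm : ∀ U : EuclideanSpace ℂ (Fin n) ≃ₗᵢ[ℂ] EuclideanSpace ℂ (Fin n), m.map (actU U) = m)
    (k : ℕ) (d : Fin n → ℂ) :
    ∫⁻ y, ENNReal.ofReal ((2 * ipB y d)^(2*k)) ∂m =
      ENNReal.ofReal ((∑ i, ‖d i‖^2)^k) * ∫⁻ y, ENNReal.ofReal ((2 * (y i₀).re)^(2*k)) ∂m := by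
  set Q := ∑ i, ‖d i‖^2 with hQ
  have hQ0 : 0 ≤ Q := Finset.sum_nonneg fun i _ => by positivity
  let d' : Fin n → ℂ := Pi.single i₀ ((√Q : ℝ) : ℂ)
  have hd' : ∑ i, ‖d' i‖^2 = ∑ i, ‖d i‖^2 := by
    rw [← hQ, Finset.sum_eq_single i₀]
    · simp [d', sq_sqrt hQ0]
    · intro j _ hj
      simp [d', Pi.single_eq_of_ne hj]
    · simp
  obtain ⟨U, hU⟩ := exists_actU d' d hd'
  have hB : ∀ y, ipB y d' = √Q * (y i₀).re := by
    intro y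
    unfold ipB
    rw [Finset.sum_eq_single i₀]
    · simp [d', mul_comm]
    · intro j _ hj
      simp [d', Pi.single_eq_of_ne hj]
    · simp
  have hmeas := ipB_meas_left d
  nth_rewrite 1 [← hm U]
  rw [lintegral_map (by fun_prop) (actU_continuous U).measurable,
    ← lintegral_const_mul _ (by fun_prop)]
  refine lintegral_congr fun y => ?_
  rw [← hU, ipB_act, hB, ← ENNReal.ofReal_mul (by positivity)]
  congr 1
  have : (√Q)^(2*k) = Q^k := by rw [pow_mul, sq_sqrt hQ0]
  rw [← this]
  ring

lemma muD_moment {n : ℕ} (hn : 1 ≤ n) (R : ℝ) (hR : 0 ≤ R) (m : Measure (Fin n → ℂ))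
    [IsProbabilityMeasure m]
    (hm : ∀ U : EuclideanSpace ℂ (Fin n) ≃ₗᵢ[ℂ] EuclideanSpace ℂ (Fin n), m.map (actU U) = m)
    (hs : ∀ᵐ d ∂m, ∑ i, ‖d i‖^2 = R) (k : ℕ) (y : Fin n → ℂ) :
    ∫⁻ d, ENNReal.ofReal ((2 * ipB d y)^(2*k)) ∂m =
      ENNReal.ofReal ((∑ i, ‖y i‖^2)^k * (R^k * ((2*k).factorial / k.factorial) 
        * (Gamma n / Gamma (n+k)))) := by
  let i₀ : Fin n := ⟨0, hn⟩
  have hG : 0 < Gamma n := Gamma_pos_of_pos (by exact_mod_cast hn)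
  have hGk : 0 < Gamma (n + k) := Gamma_pos_of_pos (by 
    have : (1:ℝ) ≤ n := by exact_mod_cast hn
    positivity)
  rw [moment_inv i₀ m hm k y, ENNReal.ofReal_mul (by positivity)]
  congr 1
  set c := ∫⁻ d, ENNReal.ofReal ((2 * (d i₀).re)^(2*k)) ∂m with hc
  have hBm : Measurable (fun p : (Fin n → ℂ) × (Fin n → ℂ) => ipB p.1 p.2) := ipB_meas
  have key : ∫⁻ y, ∫⁻ d, ENNReal.ofReal ((2 * ipB d y)^(2*k)) ∂m ∂(gam n) = 
    ∫⁻ d, ∫⁻ y, ENNReal.ofReal ((2 * ipB d y)^(2*k)) ∂(gam n) ∂m := 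
    lintegral_lintegral_swap (by 
      have : Measurable (fun p : (Fin n → ℂ) × (Fin n → ℂ) => ipB p.2 p.1) :=
        ipB_meas.comp measurable_swap
      exact (by fun_prop : Measurable fun p : (Fin n → ℂ) × (Fin n → ℂ) => 
        ENNReal.ofReal ((2 * ipB p.2 p.1)^(2*k))).aemeasurable)
  have hl : ∫⁻ y, ∫⁻ d, ENNReal.ofReal ((2 * ipB d y)^(2*k)) ∂m ∂(gam n) =
      ENNReal.ofReal (Gamma (n + k) / Gamma n) * c := by
    rw [lintegral_congr fun y => moment_inv i₀ m hm k y,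
      lintegral_mul_const _ (by fun_prop), gam_radial' n hn k]
  have hr : ∫⁻ d, ∫⁻ y, ENNReal.ofReal ((2 * ipB d y)^(2*k)) ∂(gam n) ∂m =
      ENNReal.ofReal (R^k * ((2*k).factorial / k.factorial)) := by
    have : ∀ᵐ d ∂m, ∫⁻ y, ENNReal.ofReal ((2 * ipB d y)^(2*k)) ∂(gam n) =
        ENNReal.ofReal (R^k * ((2*k).factorial / k.factorial)) := by
      filter_upwards [hs] with d hd
      simp_rw [ipB_comm d]
      rw [moment_inv i₀ (gam n) gam_mp k d, gam_moment, hd, ENNReal.ofReal_mul (by positivity)]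
    rw [lintegral_congr_ae this]
    simp
  rw [hl, hr] at key
  have h2 : ENNReal.ofReal (Gamma n / Gamma (n + k)) * ENNReal.ofReal (Gamma (n + k) / Gamma n) = 1 := by
    rw [← ENNReal.ofReal_mul (by positivity), ENNReal.ofReal_eq_one]
    field_simp
  calc c = ENNReal.ofReal (Gamma n / Gamma (n + k)) * (ENNReal.ofReal (Gamma (n + k) / Gamma n) * c) := by
        rw [← mul_assoc, h2, one_mul]
    _ = _ := by
        rw [key, ← ENNReal.ofReal_mul (by positivity), mul_comm]

lemma muD_exp {n : ℕ} (hn : 1 ≤ n) (R : ℝ) (hR : 0 ≤ R) (m : Measure (Fin n → ℂ))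
    [IsProbabilityMeasure m]
    (hm : ∀ U : EuclideanSpace ℂ (Fin n) ≃ₗᵢ[ℂ] EuclideanSpace ℂ (Fin n), m.map (actU U) = m)
    (hs : ∀ᵐ d ∂m, ∑ i, ‖d i‖^2 = R) (y : Fin n → ℂ) :
    ∫⁻ d, ENNReal.ofReal (exp (2 * ipB d y)) ∂m =
      ∑' k : ℕ, ENNReal.ofReal (((∑ i, ‖y i‖^2) * R)^k * Gamma n / (k.factorial * Gamma (n+k))) := by
  have hmeas := ipB_meas_left y
  have hneg : ∫⁻ d, ENNReal.ofReal (exp (2 * ipB d y)) ∂m =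
      ∫⁻ d, ENNReal.ofReal (exp (-(2 * ipB d y))) ∂m := by
    nth_rewrite 1 [← hm (LinearIsometryEquiv.neg ℂ)]
    rw [lintegral_map (by fun_prop) (actU_continuous _).measurable]
    refine lintegral_congr fun d => ?_
    congr 2
    unfold ipB
    rw [← mul_neg, ← Finset.sum_neg_distrib]
    congr 1
    refine Finset.sum_congr rfl fun i _ => ?_
    simp [actU]
  have hcosh : ∫⁻ d, ENNReal.ofReal (exp (2 * ipB d y)) ∂m =
      ∫⁻ d, ENNReal.ofReal (cosh (2 * ipB d y)) ∂m := by
    have h2 : 2 * ∫⁻ d, ENNReal.ofReal (exp (2 * ipB d y)) ∂m =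
      2 * ∫⁻ d, ENNReal.ofReal (cosh (2 * ipB d y)) ∂m := by
      rw [two_mul]
      nth_rewrite 2 [hneg]
      have hcm : Measurable fun d => ENNReal.ofReal (cosh (2 * ipB d y)) :=
        ENNReal.measurable_ofReal.comp (continuous_cosh.measurable.comp (by fun_prop))
      rw [← lintegral_add_left (by fun_prop), ← lintegral_const_mul _ hcm]
      refine lintegral_congr fun d => ?_
      rw [← ENNReal.ofReal_add (by positivity) (by positivity), cosh_eq, 
        show (2 : ENNReal) = ENNReal.ofReal 2 by simp, ← ENNReal.ofReal_mul (by norm_num)]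
      congr 1
      ring
    exact (ENNReal.mul_right_inj (by norm_num) (by norm_num)).1 h2
  rw [hcosh]
  have hser : ∀ d, ENNReal.ofReal (cosh (2 * ipB d y)) = 
      ∑' k : ℕ, ENNReal.ofReal ((2 * ipB d y)^(2*k)) * ENNReal.ofReal ((((2*k).factorial : ℕ) : ℝ)⁻¹) := by
    intro d
    have h := hasSum_cosh (2 * ipB d y)
    have hpos : ∀ k : ℕ, 0 ≤ (2 * ipB d y)^(2*k) := fun k => by rw [pow_mul]; positivity
    rw [← h.tsum_eq, ENNReal.ofReal_tsum_of_nonneg 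
      (fun k => div_nonneg (hpos k) (by positivity)) h.summable]
    refine tsum_congr fun k => ?_
    rw [← ENNReal.ofReal_mul (hpos k)]
    rfl
  simp_rw [hser]
  rw [lintegral_tsum (fun k => by fun_prop)]
  refine tsum_congr fun k => ?_
  have hGk : 0 < Gamma (n + k) := Gamma_pos_of_pos (by 
    have : (1:ℝ) ≤ n := by exact_mod_cast hn
    positivity)
  have hG : 0 < Gamma n := Gamma_pos_of_pos (by exact_mod_cast hn)
  rw [lintegral_mul_const _ (by fun_prop), muD_moment hn R hR m hm hs k y, 
    ← ENNReal.ofReal_mul (by positivity)]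
  congr 1
  have h1 := k.factorial_pos
  have h2 := (2*k).factorial_pos
  field_simp
  rw [mul_pow]

lemma summ {n : ℕ} (hn : 1 ≤ n) (x : ℝ) (hx : 0 ≤ x) : 
    Summable fun k : ℕ => x^k * Gamma n / (k.factorial * Gamma (n+k)) := by
  refine Summable.of_nonneg_of_le (fun k => ?_) (fun k => ?_) (summable_pow_div_factorial x)
  all_goals
    have hGk : 0 < Gamma (n + k) := Gamma_pos_of_pos (by 
      have : (1:ℝ) ≤ n := by exact_mod_cast hn
      positivity)
    have hG : 0 < Gamma n := Gamma_pos_of_pos (by exact_mod_cast hn)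
  · positivity
  · have hle : Gamma n ≤ Gamma (n + k) := by
      obtain ⟨j, rfl⟩ : ∃ j, n = j + 1 := ⟨n - 1, by omega⟩
      have e : ((j + 1 : ℕ) : ℝ) + k = ((j + k : ℕ) : ℝ) + 1 := by push_cast; ring
      rw [e, Gamma_nat_eq_factorial]
      push_cast
      rw [Gamma_nat_eq_factorial]
      exact_mod_cast Nat.factorial_le (by omega)
    have h1 := k.factorial_pos
    rw [mul_div_mul_comm]
    exact mul_le_of_le_one_right (by positivity) ((div_le_one hGk).2 hle)

lemma conv_density {n : ℕ} (m : Measure (Fin n → ℂ)) [IsProbabilityMeasure m] :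
    (m.prod (gam n)).map (fun p => p.1 + p.2) = volume.withDensity (fun y : Fin n → ℂ =>
      ∫⁻ d, ENNReal.ofReal ((π⁻¹)^n * exp (-∑ i, ‖(y - d) i‖^2)) ∂m) := by
  ext s hs
  have hmeas : Measurable (fun p : (Fin n → ℂ) × (Fin n → ℂ) => p.1 + p.2) := by fun_prop
  rw [Measure.map_apply hmeas hs, Measure.prod_apply (hmeas hs), withDensity_apply _ hs,
    lintegral_lintegral_swap (by fun_prop)]
  refine lintegral_congr fun d => ?_
  have hm2 : Measurable (fun w : Fin n → ℂ => d + w) := by fun_prop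
  rw [gam_eq, withDensity_apply _ (measurable_prodMk_left (hmeas hs))]
  rw [← lintegral_indicator hs, ← lintegral_indicator (measurable_prodMk_left (hmeas hs)),
    ← lintegral_add_left_eq_self (s.indicator _) d]
  refine lintegral_congr fun w => ?_
  simp [Set.indicator]
  rfl

lemma bessel_match {n : ℕ} (R Q : ℝ) (hR : 0 < R) (hQ : 0 < Q) :
    Gamma n * π ^ (-(n : ℝ)) * R ^ ((1 - (n : ℝ)) / 2) * √Q ^ (1 - (n : ℝ))
          * exp (-(Q + R)) * besselI ((n : ℝ) - 1) (2 * √Q * √R) =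
    ((π⁻¹)^n * exp (-(Q + R))) * ∑' k : ℕ, (Q * R)^k * Gamma n / (k.factorial * Gamma (n+k)) := by
  have hsQ : 0 < √Q := sqrt_pos.2 hQ
  have hsR : 0 < √R := sqrt_pos.2 hR
  rw [besselI, rpow_neg pi_pos.le, rpow_natCast, ← inv_pow, ← tsum_mul_left, ← tsum_mul_left]
  refine tsum_congr fun k => ?_
  have e1 : 2 * √Q * √R / 2 = √Q * √R := by ring
  have e2 : (k : ℝ) + ((n : ℝ) - 1) + 1 = n + k := by ring
  have e3 : R ^ ((1 - (n : ℝ)) / 2) = √R ^ (1 - (n : ℝ)) := by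
    rw [sqrt_eq_rpow, ← rpow_mul hR.le]; ring_nf
  have e4 : (√Q * √R) ^ (2 * (k : ℝ) + ((n : ℝ) - 1)) * (√R ^ (1 - (n : ℝ)) * √Q ^ (1 - (n : ℝ)))
      = (Q * R)^k := by
    rw [← mul_rpow hsR.le hsQ.le, mul_comm √R, ← rpow_add (by positivity),
      show 2 * (k : ℝ) + ((n : ℝ) - 1) + (1 - n) = ((2 * k : ℕ) : ℝ) by push_cast; ring,
      rpow_natCast, pow_mul, mul_pow, sq_sqrt hQ.le, sq_sqrt hR.le]
  rw [e1, e2, e3, ← e4]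
  ring

/-- density of `Y = D + W` for `D` uniform on the complex sphere
`{d ∈ ℂⁿ : ‖d‖² = nρ}` (a unitarily invariant probability measure on that sphere) and
`W ~ CN(0, Iₙ)` independent of `D`, with respect to Lebesgue measure on `ℂⁿ ≅ ℝ²ⁿ`:
`p_Y(y) = Γ(n) π^{−n} (nρ)^{(1−n)/2} ‖y‖^{1−n} e^{−(‖y‖²+nρ)} I_{n−1}(2‖y‖√(nρ))`. -/
theorem stmt10 (n : ℕ) (hn : 1 ≤ n) (ρ : ℝ) (hρ : 0 < ρ)
    (μD : Measure (Fin n → ℂ)) [IsProbabilityMeasure μD]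
    (hsupp : μD {d : Fin n → ℂ | ∑ i, ‖d i‖ ^ 2 = n * ρ} = 1)
    (hrot : ∀ U : EuclideanSpace ℂ (Fin n) ≃ₗᵢ[ℂ] EuclideanSpace ℂ (Fin n),
      μD.map (fun d : Fin n → ℂ =>
        WithLp.equiv 2 (Fin n → ℂ) (U ((WithLp.equiv 2 (Fin n → ℂ)).symm d))) = μD)
    (μW : Measure (Fin n → ℂ))
    (hW : μW = Measure.pi (fun _ : Fin n => complexGaussian (1 / 2))) :
    (μD.prod μW).map (fun p => p.1 + p.2) =
      volume.withDensity (fun y : Fin n → ℂ => ENNReal.ofReal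
        (Real.Gamma n * Real.pi ^ (-(n : ℝ))
          * (n * ρ) ^ ((1 - (n : ℝ)) / 2)
          * Real.sqrt (∑ i, ‖y i‖ ^ 2) ^ (1 - (n : ℝ))
          * Real.exp (-((∑ i, ‖y i‖ ^ 2) + n * ρ))
          * besselI ((n : ℝ) - 1)
              (2 * Real.sqrt (∑ i, ‖y i‖ ^ 2) * Real.sqrt (n * ρ)))) := by
  subst hW
  have hn0 : (0:ℝ) < n := by exact_mod_cast hn
  have hR : 0 < n * ρ := by positivity
  have hs : ∀ᵐ d ∂μD, ∑ i, ‖d i‖^2 = n * ρ := by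
    have hms : MeasurableSet {d : Fin n → ℂ | ∑ i, ‖d i‖ ^ 2 = n * ρ} :=
      measurableSet_eq_fun (by fun_prop) (by fun_prop)
    exact (mem_ae_iff_prob_eq_one hms).2 hsupp
  have : Nonempty (Fin n) := ⟨⟨0, hn⟩⟩
  refine (conv_density μD).trans ?_
  refine withDensity_congr_ae ?_
  have h0 : ∀ᵐ y : Fin n → ℂ, y ≠ 0 := by
    rw [ae_iff]; simp
  filter_upwards [h0] with y hy
  have hQ : 0 < ∑ i, ‖y i‖^2 := by
    rw [q_eq]
    have : WithLp.toLp 2 y ≠ 0 := by simpa using hy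
    positivity
  rw [bessel_match _ _ hR hQ, ENNReal.ofReal_mul (by positivity)]
  have hG : 0 < Gamma n := Gamma_pos_of_pos hn0
  rw [ENNReal.ofReal_tsum_of_nonneg (fun k => by
      have : 0 < Gamma (n + k) := Gamma_pos_of_pos (by positivity)
      positivity) (summ hn _ (by positivity)),
    ← muD_exp hn _ hR.le μD hrot hs y, ← lintegral_const_mul _ (by
      have := ipB_meas_left y
      fun_prop)]
  refine lintegral_congr_ae ?_
  filter_upwards [hs] with d hd
  rw [← ENNReal.ofReal_mul (by positivity), mul_assoc, ← Real.exp_add]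
  congr 3
  rw [← hd, ipB, Finset.mul_sum, neg_add, ← Finset.sum_neg_distrib, ← Finset.sum_neg_distrib,
    ← Finset.sum_neg_distrib, ← Finset.sum_add_distrib, ← Finset.sum_add_distrib]
  refine Finset.sum_congr rfl fun i _ => ?_
  simp only [Pi.sub_apply, ← Complex.normSq_eq_norm_sq, Complex.normSq_apply]
  simp
  ring
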